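/- arXiv:1910.14534 — 3 statements merged into one kernel-verified Lean document; each statement's English description precedes it below -/
import Mathlib

section
/- Let 𝓑 and 𝓐 be abelian categories and let a : 𝓑 → 𝓐 be an exact functor which is left adjoint to a functor i : 𝓐 → 𝓑. Suppose 𝓐 has enough injectives. Then for every object A of 𝓐, every projective object B of 𝓑, and every q ≥ 0 there is a natural isomorphism Hom_𝓑(B, (R^q i)(A)) ≅ Ext^q_𝓐(a(B), A), where R^q i denotes the q-th right derived functor of the (left exact) functor i. -/
/-!
Statement 0 (the collapsed case of Proposition A.2 of the paper): if `a : B ⥤ A` is an exact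
functor between abelian categories, left adjoint to `i : A ⥤ B`, `A` has enough injectives,
`P : B` is projective and `q ≥ 0`, then there is an isomorphism
`Hom_B(P, (R^q i)(X)) ≅ Ext^q_A(a(P), X)`, natural in `X : A`.
-/

open CategoryTheory Limits

universe w v u v' u'

/-- Two surjective homomorphisms with the same kernel have isomorphic targets, compatibly. -/
lemma AddMonoidHom.exists_addEquiv_of_ker_eq {G H K : Type*} [AddCommGroup G] [AddCommGroup H]
    [AddCommGroup K] (f : G →+ H) (g : G →+ K) (hf : Function.Surjective f)
    (hg : Function.Surjective g) (h : ∀ x, f x = 0 ↔ g x = 0) :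
    ∃ e : H ≃+ K, ∀ x, e (f x) = g x := by
  have hker : f.ker = g.ker := by
    ext x
    exact h x
  refine ⟨(QuotientAddGroup.quotientKerEquivOfSurjective f hf).symm.trans
    ((QuotientAddGroup.quotientAddEquivOfEq hker).trans
      (QuotientAddGroup.quotientKerEquivOfSurjective g hg)), fun x => ?_⟩
  have hx : (QuotientAddGroup.quotientKerEquivOfSurjective f hf).symm (f x) =
      (x : G ⧸ f.ker) := by
    rw [AddEquiv.symm_apply_eq]
    rfl
  simp only [AddEquiv.trans_apply, hx]
  rfl

namespace HomologicalComplex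

variable {C ι : Type*} [Category* C] [Abelian C] {c : ComplexShape ι}

/-- A map from a projective object to the cycles vanishes in homology if and only if it lifts
to a boundary. -/
lemma comp_homologyπ_eq_zero_iff_of_projective (K : HomologicalComplex C c) (j : ι) {P : C}
    [Projective P] (z : P ⟶ K.cycles j) :
    z ≫ K.homologyπ j = 0 ↔ ∃ g : P ⟶ K.X (c.prev j), g ≫ K.d (c.prev j) j = z ≫ K.iCycles j := by
  constructor
  · intro hz
    have hexact : (ShortComplex.mk (K.toCycles (c.prev j) j) (K.homologyπ j)
        (K.toCycles_comp_homologyπ _ _)).Exact :=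
      ShortComplex.exact_of_g_is_cokernel _ (K.homologyIsCokernel _ j rfl)
    refine ⟨hexact.liftFromProjective z hz, ?_⟩
    have := hexact.liftFromProjective_comp z hz
    dsimp only at this
    rw [← K.toCycles_i, ← Category.assoc, this]
  · rintro ⟨g, hg⟩
    have : z = g ≫ K.toCycles (c.prev j) j := by
      rw [← cancel_mono (K.iCycles j), Category.assoc, K.toCycles_i, hg]
    rw [this, Category.assoc, K.toCycles_comp_homologyπ, comp_zero]

end HomologicalComplex

namespace CategoryTheory.InjectiveResolution

open CochainComplex HomComplex

variable {C : Type u} [Category.{v} C] [Abelian C] [HasExt.{w} C]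

lemma extMk_eq_zero_iff_of_degree_zero {X Y : C} (R : InjectiveResolution Y)
    (f : X ⟶ R.cocomplex.X 0) (hf : f ≫ R.cocomplex.d 0 1 = 0) :
    R.extMk f 1 rfl hf = 0 ↔ f = 0 := by
  simp only [← R.extEquivCohomologyClass.apply_eq_iff_eq,
    extEquivCohomologyClass_extMk, extEquivCohomologyClass_zero, CohomologyClass.mk_eq_zero_iff]
  rw [Cocycle.fromSingleMk_mem_coboundaries_iff _ _ _ _ _ (-1) (by lia)]
  constructor
  · rintro ⟨g, hg⟩
    rw [← cancel_mono (R.cochainComplexXIso 0 0 rfl).inv, zero_comp]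
    refine hg.symm.trans ?_
    rw [(CochainComplex.isZero_of_isStrictlyGE R.cochainComplex 0 (-1)).eq_of_tgt g 0, zero_comp]
  · rintro rfl
    exact ⟨0, by simp⟩

lemma extMk_eq_zero_iff_exists_prev {X Y : C} (R : InjectiveResolution Y) {n : ℕ}
    (f : X ⟶ R.cocomplex.X n) (hf : f ≫ R.cocomplex.d n (n + 1) = 0) :
    R.extMk f (n + 1) rfl hf = 0 ↔ ∃ g : X ⟶ R.cocomplex.X ((ComplexShape.up ℕ).prev n),
      g ≫ R.cocomplex.d _ n = f := by
  cases n with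
  | zero =>
    rw [extMk_eq_zero_iff_of_degree_zero]
    simp [eq_comm]
  | succ p =>
    rw [CochainComplex.prev_nat_succ]
    exact R.extMk_eq_zero_iff f (p + 2) rfl hf p rfl

end CategoryTheory.InjectiveResolution

namespace CategoryTheory.Functor

variable {A B : Type*} [Category* A] [Abelian A] [Category* B] [Abelian B]
  (i : A ⥤ B) [i.Additive]

/-- The inclusion of the `q`-cycles of `i(K)` into `i(K.X q)`. -/
noncomputable def mapCyclesι (K : CochainComplex A ℕ) (q : ℕ) :
    ((i.mapHomologicalComplex _).obj K).cycles q ⟶ i.obj (K.X q) :=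
  ((i.mapHomologicalComplex _).obj K).iCycles q

lemma mapCyclesι_comp_map_d (K : CochainComplex A ℕ) (q : ℕ) :
    i.mapCyclesι K q ≫ i.map (K.d q (q + 1)) = 0 :=
  ((i.mapHomologicalComplex _).obj K).iCycles_d q (q + 1)

lemma exists_comp_mapCyclesι (K : CochainComplex A ℕ) (q : ℕ) {P : B} (f : P ⟶ i.obj (K.X q))
    (hf : f ≫ i.map (K.d q (q + 1)) = 0) : ∃ z, z ≫ i.mapCyclesι K q = f :=
  ⟨((i.mapHomologicalComplex _).obj K).liftCycles f (q + 1) (by simp) hf,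
    ((i.mapHomologicalComplex _).obj K).liftCycles_i f (q + 1) (by simp) hf⟩

lemma cyclesMap_comp_mapCyclesι {K L : CochainComplex A ℕ} (φ : K ⟶ L) (q : ℕ) :
    HomologicalComplex.cyclesMap ((i.mapHomologicalComplex _).map φ) q ≫ i.mapCyclesι L q =
      i.mapCyclesι K q ≫ i.map (φ.f q) :=
  HomologicalComplex.cyclesMap_i ((i.mapHomologicalComplex _).map φ) q

lemma comp_map_homologyπ_eq_zero_iff (K : CochainComplex A ℕ) (q : ℕ) {P : B} [Projective P]
    (z : P ⟶ ((i.mapHomologicalComplex _).obj K).cycles q) :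
    z ≫ ((i.mapHomologicalComplex _).obj K).homologyπ q = 0 ↔
      ∃ g : P ⟶ i.obj (K.X ((ComplexShape.up ℕ).prev q)),
        g ≫ i.map (K.d _ q) = z ≫ i.mapCyclesι K q :=
  ((i.mapHomologicalComplex _).obj K).comp_homologyπ_eq_zero_iff_of_projective q z

end CategoryTheory.Functor

namespace CategoryTheory.Adjunction

section

variable {A B : Type*} [Category* A] [Preadditive A] [Category* B] [Preadditive B]
  {a : B ⥤ A} {i : A ⥤ B} [i.Additive] (adj : a ⊣ i)

lemma homEquiv_symm_comp_eq_zero_iff {P : B} {Y Z : A} (f : P ⟶ i.obj Y) (d : Y ⟶ Z) :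
    (adj.homEquiv P Y).symm f ≫ d = 0 ↔ f ≫ i.map d = 0 := by
  rw [← adj.homEquiv_naturality_right_symm, Equiv.symm_apply_eq, adj.homEquiv_unit,
    i.map_zero, comp_zero]

lemma homEquiv_symm_add {P : B} {Y : A} (f g : P ⟶ i.obj Y) :
    (adj.homEquiv P Y).symm (f + g) = (adj.homEquiv P Y).symm f + (adj.homEquiv P Y).symm g := by
  rw [Equiv.symm_apply_eq, adj.homEquiv_unit, i.map_add, Preadditive.comp_add,
    ← adj.homEquiv_unit, ← adj.homEquiv_unit, Equiv.apply_symm_apply, Equiv.apply_symm_apply]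

end

variable {A : Type u} [Category.{v} A] [Abelian A] [HasExt.{w} A]
  {B : Type u'} [Category.{v'} B] [Abelian B]
  {a : B ⥤ A} {i : A ⥤ B} [i.Additive] (adj : a ⊣ i)

/-- For `I` an injective resolution of `X` and an adjunction `a ⊣ i`, the map sending a cycle of
`i(I)` defined over `P` to the class of its adjoint in `Ext (a P) X q`. -/
noncomputable def cyclesToExt {X : A} (I : InjectiveResolution X) (P : B) (q : ℕ) :
    (P ⟶ ((i.mapHomologicalComplex _).obj I.cocomplex).cycles q) →+
      Abelian.Ext (a.obj P) X q :=
  AddMonoidHom.mk'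
    (fun z => I.extMk ((adj.homEquiv P _).symm (z ≫ i.mapCyclesι I.cocomplex q)) (q + 1) rfl (by
      rw [homEquiv_symm_comp_eq_zero_iff, Category.assoc, i.mapCyclesι_comp_map_d, comp_zero]))
    (fun z z' => by
      rw [I.add_extMk]
      congr 1
      rw [Preadditive.add_comp, homEquiv_symm_add])

lemma cyclesToExt_apply {X : A} (I : InjectiveResolution X) {P : B} {q : ℕ}
    (z : P ⟶ ((i.mapHomologicalComplex _).obj I.cocomplex).cycles q) :
    adj.cyclesToExt I P q z =
      I.extMk ((adj.homEquiv P _).symm (z ≫ i.mapCyclesι I.cocomplex q)) (q + 1) rfl (by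
        rw [homEquiv_symm_comp_eq_zero_iff, Category.assoc, i.mapCyclesι_comp_map_d,
          comp_zero]) :=
  rfl

lemma cyclesToExt_surjective {X : A} (I : InjectiveResolution X) (P : B) (q : ℕ) :
    Function.Surjective (adj.cyclesToExt I P q) := by
  intro α
  obtain ⟨f, hf, rfl⟩ := I.extMk_surjective α (q + 1) rfl
  obtain ⟨f, rfl⟩ := (adj.homEquiv P _).symm.surjective f
  obtain ⟨z, rfl⟩ := i.exists_comp_mapCyclesι _ _ f
    ((adj.homEquiv_symm_comp_eq_zero_iff _ _).1 hf)
  exact ⟨z, rfl⟩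

lemma cyclesToExt_eq_zero_iff {X : A} (I : InjectiveResolution X) {P : B} [Projective P] {q : ℕ}
    (z : P ⟶ ((i.mapHomologicalComplex _).obj I.cocomplex).cycles q) :
    adj.cyclesToExt I P q z = 0 ↔
      z ≫ ((i.mapHomologicalComplex _).obj I.cocomplex).homologyπ q = 0 := by
  rw [cyclesToExt_apply, i.comp_map_homologyπ_eq_zero_iff, I.extMk_eq_zero_iff_exists_prev]
  refine (adj.homEquiv P _).exists_congr fun g => ?_
  rw [Equiv.eq_symm_apply, adj.homEquiv_naturality_right]

lemma cyclesToExt_naturality {X Y : A} {I : InjectiveResolution X} {J : InjectiveResolution Y}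
    {f : X ⟶ Y} (φ : I.Hom J f) {P : B} {q : ℕ}
    (z : P ⟶ ((i.mapHomologicalComplex _).obj I.cocomplex).cycles q) :
    adj.cyclesToExt J P q
        (z ≫ HomologicalComplex.cyclesMap ((i.mapHomologicalComplex _).map φ.hom) q) =
      (adj.cyclesToExt I P q z).comp (Abelian.Ext.mk₀ f) (add_zero q) := by
  rw [cyclesToExt_apply, cyclesToExt_apply, InjectiveResolution.extMk_comp_mk₀ _ _ rfl _ φ]
  congr 1
  rw [Category.assoc, i.cyclesMap_comp_mapCyclesι, ← Category.assoc,
    adj.homEquiv_naturality_right_symm]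

end CategoryTheory.Adjunction

theorem stmt_0
    {A : Type u} [Category.{v} A] [Abelian A] [EnoughInjectives A] [HasExt.{w} A]
    {B : Type u'} [Category.{v'} B] [Abelian B]
    (a : B ⥤ A) (i : A ⥤ B) [i.Additive]
    [PreservesFiniteLimits a] [PreservesFiniteColimits a]
    (adj : a ⊣ i)
    (P : B) [Projective P] (q : ℕ) :
    ∃ e : ∀ X : A, (P ⟶ (i.rightDerived q).obj X) ≃+ Abelian.Ext (a.obj P) X q,
      ∀ (X Y : A) (φ : X ⟶ Y) (g : P ⟶ (i.rightDerived q).obj X),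
        e Y (g ≫ (i.rightDerived q).map φ) =
          (e X g).comp (Abelian.Ext.mk₀ φ) (add_zero q) := by
  let I (X : A) : InjectiveResolution X := injectiveResolution X
  let H (X : A) : (i.rightDerived q).obj X ≅
      ((i.mapHomologicalComplex _).obj (I X).cocomplex).homology q := (I X).isoRightDerivedObj i q
  let π (X : A) := ((i.mapHomologicalComplex _).obj (I X).cocomplex).homologyπ q
  have (X : A) : Epi (π X) := inferInstanceAs (Epi (HomologicalComplex.homologyπ _ q))
  let p (X : A) : (P ⟶ _) →+ (P ⟶ (i.rightDerived q).obj X) :=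
    Preadditive.rightComp P (π X ≫ (H X).inv)
  have p_apply (X : A) (z) : p X z = z ≫ π X ≫ (H X).inv := rfl
  have p_surj (X : A) : Function.Surjective (p X) := fun g => by
    refine ⟨Projective.factorThru (g ≫ (H X).hom) (π X), ?_⟩
    rw [p_apply, ← Category.assoc, Projective.factorThru_comp, Category.assoc,
      Iso.hom_inv_id, Category.comp_id]
  have p_ker (X : A) (z) : p X z = 0 ↔ adj.cyclesToExt (I X) P q z = 0 := by
    rw [adj.cyclesToExt_eq_zero_iff, p_apply, ← Category.assoc]
    exact Preadditive.IsIso.comp_right_eq_zero _ _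
  choose e he using fun X : A => AddMonoidHom.exists_addEquiv_of_ker_eq
    (p X) (adj.cyclesToExt (I X) P q) (p_surj X)
    (adj.cyclesToExt_surjective (I X) P q) (p_ker X)
  refine ⟨e, fun X Y φ g => ?_⟩
  obtain ⟨z, rfl⟩ := p_surj X g
  let ψ : (I X).Hom (I Y) φ :=
    { hom := InjectiveResolution.desc φ (I Y) (I X)
      ι_f_zero_comp_hom_f_zero := by
        rw [CochainComplex.single₀_map_f_zero]
        exact InjectiveResolution.desc_commutes_zero φ (I Y) (I X) }
  have hz : p X z ≫ (i.rightDerived q).map φ =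
      p Y (z ≫ HomologicalComplex.cyclesMap ((i.mapHomologicalComplex _).map ψ.hom) q) := by
    have h₁ : (H X).inv ≫ (i.rightDerived q).map φ = HomologicalComplex.homologyMap
        ((i.mapHomologicalComplex (ComplexShape.up ℕ)).map ψ.hom) q ≫ (H Y).inv :=
      InjectiveResolution.isoRightDerivedObj_inv_naturality φ (I X) (I Y) ψ.hom
        (InjectiveResolution.desc_commutes_zero φ (I Y) (I X)) i q
    have h₂ : π X ≫ HomologicalComplex.homologyMap
        ((i.mapHomologicalComplex (ComplexShape.up ℕ)).map ψ.hom) q =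
          HomologicalComplex.cyclesMap ((i.mapHomologicalComplex _).map ψ.hom) q ≫ π Y :=
      HomologicalComplex.homologyπ_naturality
        ((i.mapHomologicalComplex (ComplexShape.up ℕ)).map ψ.hom) q
    rw [p_apply, p_apply, Category.assoc, Category.assoc, Category.assoc, h₁, reassoc_of% h₂]
  rw [hz, he, he, adj.cyclesToExt_naturality ψ]
end

section
/- Let F : 𝓐 → 𝓑 be an additive functor between Grothendieck abelian categories. If F is strongly additive and exact, then the induced functor D(F) : D(𝓐) → D(𝓑) on unbounded derived categories is strongly additive, i.e., commutes with all small coproducts. -/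
/-!
Statement 4 (Proposition A.4 a) of the paper): if `F : A ⥤ B` is a strongly additive exact
functor between Grothendieck abelian categories, then the induced functor
`D(F) : D(A) ⥤ D(B)` on unbounded derived categories is strongly additive.
-/

open CategoryTheory Limits

universe w w' v u u'

/-- An additive functor is *strongly additive* if it preserves all small coproducts
(here, coproducts indexed by types in `Type w`). -/
def StronglyAdditive {C : Type u} [Category.{v} C] {D : Type u'} [Category.{v'} D]
    (F : C ⥤ D) : Prop :=
  ∀ J : Type w, Nonempty (PreservesColimitsOfShape (Discrete J) F)

namespace HomologicalComplex

variable {C : Type*} [Category* C] [HasZeroMorphisms C] {ι : Type*} {c : ComplexShape ι}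
  {J : Type*} [Category* J]

/-- A diagram of homological complexes, seen as a homological complex of diagrams. -/
@[simps]
def ofDiagram (K : J ⥤ HomologicalComplex C c) : HomologicalComplex (J ⥤ C) c where
  X n := K ⋙ eval C c n
  d n m :=
    { app j := (K.obj j).d n m
      naturality _ _ f := (K.map f).comm n m }
  d_comp_d' n m p _ _ := by
    ext j
    exact (K.obj j).d_comp_d n m p
  shape n m h := by
    ext j
    exact (K.obj j).shape n m h

/-- The morphism between the complexes of diagrams attached to a natural transformation between
diagrams of homological complexes. -/
@[simps]
def ofDiagramMap {K L : J ⥤ HomologicalComplex C c} (φ : K ⟶ L) :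
    ofDiagram K ⟶ ofDiagram L where
  f n := Functor.whiskerRight φ (eval C c n)
  comm' n m _ := by
    ext j
    exact (φ.app j).comm n m

end HomologicalComplex

namespace HomologicalComplex

variable {C : Type*} [Category* C] [Abelian C] {ι : Type*} {c : ComplexShape ι}
  {J : Type*} [Category* J]

lemma quasiIso_ofDiagramMap {K L : J ⥤ HomologicalComplex C c} (φ : K ⟶ L)
    (hφ : ∀ j, QuasiIso (φ.app j)) : QuasiIso (ofDiagramMap φ) where
  quasiIsoAt n := by
    rw [quasiIsoAt_iff, ShortComplex.quasiIso_iff, NatTrans.isIso_iff_isIso_app]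
    intro j
    have h : ShortComplex.QuasiIso (((evaluation J C).obj j).mapShortComplex.map
        ((shortComplexFunctor (J ⥤ C) c n).map (ofDiagramMap φ))) :=
      ((quasiIsoAt_iff (φ.app j) n).1 inferInstance)
    rw [ShortComplex.quasiIso_iff] at h
    exact ((MorphismProperty.isomorphisms C).arrow_mk_iso_iff
      (Arrow.isoMk (ShortComplex.mapHomologyIso _ ((evaluation J C).obj j))
        (ShortComplex.mapHomologyIso _ ((evaluation J C).obj j))
        (ShortComplex.mapHomologyIso_hom_naturality _ _).symm)).1 h

variable (C c J) in
/-- Quasi-isomorphisms are stable under exact colimits. -/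
lemma isStableUnderColimitsOfShape_quasiIso [HasColimitsOfShape J C]
    [HasExactColimitsOfShape J C] :
    (quasiIso C c).IsStableUnderColimitsOfShape J where
  condition K L cK cL hK hL f hf φ hφ := by
    have := HasExactColimitsOfShape.preservesFiniteLimits (J := J) (C := C)
    have : (colim (J := J) (C := C)).Additive :=
      have := preservesBinaryBiproducts_of_preservesBinaryCoproducts (colim (J := J) (C := C))
      Functor.additive_of_preservesBinaryBiproducts _
    have := quasiIso_ofDiagramMap f hf
    let α {M : J ⥤ HomologicalComplex C c} {cM : Cocone M} (hM : IsColimit cM) (n : ι) :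
        colimit (M ⋙ eval C c n) ≅ cM.pt.X n :=
      (colimit.isColimit _).coconePointUniqueUpToIso (isColimitOfPreserves (eval C c n) hM)
    have hα {M : J ⥤ HomologicalComplex C c} {cM : Cocone M} (hM : IsColimit cM) (n : ι) (j : J) :
        colimit.ι (M ⋙ eval C c n) j ≫ (α hM n).hom = (cM.ι.app j).f n :=
      (colimit.isColimit _).comp_coconePointUniqueUpToIso_hom _ j
    let e {M : J ⥤ HomologicalComplex C c} {cM : Cocone M} (hM : IsColimit cM) :
        (colim.mapHomologicalComplex c).obj (ofDiagram M) ≅ cM.pt :=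
      Hom.isoOfComponents (α hM) (fun n m _ ↦ colimit.hom_ext (fun j ↦ by
        have h : colimit.ι (M ⋙ eval C c n) j ≫ colimMap ((ofDiagram M).d n m) =
          (M.obj j).d n m ≫ colimit.ι (M ⋙ eval C c m) j := ι_colimMap ((ofDiagram M).d n m) j
        exact ((reassoc_of% hα hM n j) _).trans (((cM.ι.app j).comm n m).trans
          (((reassoc_of% h) _).trans ((Category.assoc _ _ _).trans
            ((M.obj j).d n m ≫= hα hM m j))).symm)))
    refine (quasiIso_iff_of_arrow_mk_iso _ _ (Arrow.isoMk (e hK) (e hL) ?_)).1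
      (quasiIso_map_of_preservesHomology (ofDiagramMap f) colim)
    ext n
    refine colimit.hom_ext (fun j ↦ ?_)
    have h : colimit.ι (K ⋙ eval C c n) j ≫ colimMap ((ofDiagramMap f).f n) =
      (f.app j).f n ≫ colimit.ι (L ⋙ eval C c n) j := ι_colimMap ((ofDiagramMap f).f n) j
    exact ((reassoc_of% hα hK n j) _).trans ((congr_hom (hφ j) n).trans
      (((reassoc_of% h) _).trans ((Category.assoc _ _ _).trans
        ((f.app j).f n ≫= hα hL n j))).symm)

end HomologicalComplex

namespace DerivedCategory

variable {C : Type*} [Category* C] [Abelian C] [HasDerivedCategory C]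

/-- A morphism of complexes which vanishes in the derived category vanishes up to a
quasi-isomorphism after factoring through a complex which is zero in the derived category. -/
lemma exists_fac_of_Q_map_eq_zero {X Y : CochainComplex C ℤ} (h : X ⟶ Y) (hh : Q.map h = 0) :
    ∃ (X' N : CochainComplex C ℤ) (s : X' ⟶ X) (i : X' ⟶ N) (p : N ⟶ Y),
      QuasiIso s ∧ IsZero (Q.obj N) ∧ s ≫ h = i ≫ p := by
  have h₀ : Qh.map ((HomotopyCategory.quotient _ _).map h) =
      Qh.map ((HomotopyCategory.quotient _ _).map 0) := by
    have h₁ := quotientCompQhIso_hom_naturality h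
    rw [hh, comp_zero, Preadditive.IsIso.comp_right_eq_zero] at h₁
    simpa using h₁
  obtain ⟨X', s, hs, fac⟩ := (MorphismProperty.map_eq_iff_precomp Qh
    (HomotopyCategory.quasiIso C (.up ℤ)) _ _).1 h₀
  obtain ⟨X', rfl⟩ := HomotopyCategory.quotient_obj_surjective X'
  obtain ⟨s, rfl⟩ := (HomotopyCategory.quotient _ _).map_surjective s
  rw [← Functor.map_comp, ← Functor.map_comp, comp_zero] at fac
  obtain ⟨z, hz⟩ := CochainComplex.HomComplex.Cochain.equivHomotopy _ _
    (HomotopyCategory.homotopyOfEq _ _ fac)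
  refine ⟨X', CochainComplex.mappingCone (𝟙 X'), s, CochainComplex.mappingCone.inr _,
    CochainComplex.mappingCone.desc (𝟙 X') z (s ≫ h) (by simpa using hz.symm), ?_, ?_, by simp⟩
  · rw [← isIso_Qh_map_iff] at hs
    exact (isIso_Q_map_iff_quasiIso C s).1 hs
  · rw [IsZero.iff_id_eq_zero, ← Q.map_id,
      Q_map_eq_of_homotopy _ (CochainComplex.mappingCone.homotopyToZeroOfId X'), Q.map_zero]

variable (J : Type*) [HasCoproductsOfShape J C] [HasExactColimitsOfShape (Discrete J) C]

variable {J} in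
lemma isIso_Q_map_colimMap {K L : Discrete J ⥤ CochainComplex C ℤ} (f : K ⟶ L)
    (hf : ∀ j, QuasiIso (f.app j)) : IsIso (Q.map (colimMap f)) := by
  have := HomologicalComplex.isStableUnderColimitsOfShape_quasiIso C (.up ℤ) (Discrete J)
  rw [isIso_Q_map_iff_quasiIso]
  exact MorphismProperty.colimMap (W := HomologicalComplex.quasiIso C (.up ℤ)) f hf

variable {J} in
lemma isZero_Q_obj_colimit (K : Discrete J ⥤ CochainComplex C ℤ)
    (hK : ∀ j, IsZero (Q.obj (K.obj j))) : IsZero (Q.obj (colimit K)) := by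
  have h : IsIso (Q.map (colimMap (0 : K ⟶ K))) := isIso_Q_map_colimMap _ (fun j ↦ by
    rw [← isIso_Q_map_iff_quasiIso]
    exact (hK j).isIso (hK j) _)
  have h₀ : colimMap (0 : K ⟶ K) = 0 := colimit.hom_ext (fun j ↦ by simp)
  rw [h₀, Q.map_zero] at h
  rw [IsZero.iff_id_eq_zero, ← IsIso.hom_inv_id (0 : Q.obj (colimit K) ⟶ Q.obj (colimit K)),
    zero_comp]

variable {J} in
lemma Q_map_colimit_hom_ext_zero {K : Discrete J ⥤ CochainComplex C ℤ} {Z : DerivedCategory C}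
    (f : Q.obj (colimit K) ⟶ Z) (hf : ∀ j, Q.map (colimit.ι K j) ≫ f = 0) : f = 0 := by
  wlog hZ : ∃ Y, Z = Q.obj Y generalizing Z
  · rw [← cancel_mono (Q.objObjPreimageIso Z).inv, zero_comp]
    exact this _ (fun j ↦ by rw [reassoc_of% hf, zero_comp]) ⟨_, rfl⟩
  obtain ⟨Y, rfl⟩ := hZ
  obtain ⟨Y', g, s, _, rfl⟩ := left_fac f
  have hg (j) : Q.map (colimit.ι K j ≫ g) = 0 := by
    rw [← cancel_mono (inv (Q.map s)), Q.map_comp, Category.assoc, hf, zero_comp]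
  choose X' N t i p ht hN fac using fun j ↦ exists_fac_of_Q_map_eq_zero _ (hg j)
  let T : Discrete.functor (fun j ↦ X' ⟨j⟩) ⟶ K := Discrete.natTrans (fun j ↦ t j)
  let I : Discrete.functor (fun j ↦ X' ⟨j⟩) ⟶ Discrete.functor (fun j ↦ N ⟨j⟩) :=
    Discrete.natTrans (fun j ↦ i j)
  let P : Discrete.functor (fun j ↦ N ⟨j⟩) ⟶ (Functor.const _).obj Y' :=
    Discrete.natTrans (fun j ↦ p j)
  have : IsIso (Q.map (colimMap T)) := isIso_Q_map_colimMap T ht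
  have h : colimMap T ≫ g = colimMap I ≫ colimit.desc _ ⟨Y', P⟩ := by
    refine colimit.hom_ext (fun j ↦ ?_)
    rw [ι_colimMap_assoc, ι_colimMap_assoc, colimit.ι_desc]
    exact fac j
  have h₀ : Q.map g = 0 := by
    rw [← cancel_epi (Q.map (colimMap T)), ← Q.map_comp, h, Q.map_comp, comp_zero,
      (isZero_Q_obj_colimit (Discrete.functor (fun j ↦ N ⟨j⟩)) (fun j ↦ hN j)).eq_of_tgt
        (Q.map (colimMap I)) 0, zero_comp]
  rw [h₀, zero_comp]

/-- The localization functor to the derived category preserves exact coproducts. -/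
lemma preservesColimitsOfShape_Q : PreservesColimitsOfShape (Discrete J) (Q (C := C)) where
  preservesColimit {K} := by
    refine preservesColimit_of_preserves_colimit_cocone (colimit.isColimit K)
      (IsColimit.ofExistsUnique (fun s ↦ existsUnique_of_exists_of_unique ?_ ?_))
    · let Y := Q.objPreimage s.pt
      let e : Q.obj Y ≅ s.pt := Q.objObjPreimageIso s.pt
      choose X' t ht g fac using fun j ↦ right_fac (X := K.obj j) (s.ι.app j ≫ e.inv)
      let T : Discrete.functor (fun j ↦ X' ⟨j⟩) ⟶ K := Discrete.natTrans (fun j ↦ t j)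
      let G : Discrete.functor (fun j ↦ X' ⟨j⟩) ⟶ (Functor.const _).obj Y :=
        Discrete.natTrans (fun j ↦ g j)
      have : IsIso (Q.map (colimMap T)) := isIso_Q_map_colimMap T
        (fun j ↦ (isIso_Q_map_iff_quasiIso _ _).1 (ht j))
      refine ⟨inv (Q.map (colimMap T)) ≫ Q.map (colimit.desc _ ⟨Y, G⟩) ≫ e.hom, fun j ↦ ?_⟩
      have h₁ : Q.map (t j) ≫ Q.map (colimit.ι K j) =
          Q.map (colimit.ι (Discrete.functor (fun j ↦ X' ⟨j⟩)) j) ≫ Q.map (colimMap T) := by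
        rw [← Q.map_comp, ← Q.map_comp]
        exact congr_arg _ (ι_colimMap T j).symm
      have h₂ : Q.map (colimit.ι (Discrete.functor (fun j ↦ X' ⟨j⟩)) j) ≫
          Q.map (colimit.desc _ ⟨Y, G⟩) = Q.map (g j) := by
        rw [← Q.map_comp, colimit.ι_desc]
        rfl
      have h₃ : Q.map (t j) ≫ s.ι.app j = Q.map (g j) ≫ e.hom := by
        have := fac j
        rw [IsIso.eq_inv_comp] at this
        simp [← this]
      dsimp
      rw [← cancel_epi (Q.map (t j)), reassoc_of% h₁, IsIso.hom_inv_id_assoc,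
        reassoc_of% h₂, h₃]
    · intro m m' hm hm'
      rw [← sub_eq_zero]
      refine Q_map_colimit_hom_ext_zero _ (fun j ↦ ?_)
      rw [Preadditive.comp_sub, sub_eq_zero]
      exact (hm j).trans (hm' j).symm

end DerivedCategory

namespace CategoryTheory

lemma Functor.preservesColimitsOfShape_mapHomologicalComplex {C D : Type*} [Category* C]
    [Category* D] [HasZeroMorphisms C] [HasZeroMorphisms D] (F : C ⥤ D) [F.PreservesZeroMorphisms]
    {ι : Type*} (c : ComplexShape ι) (J : Type*) [Category* J] [HasColimitsOfShape J C]
    [PreservesColimitsOfShape J F] :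
    PreservesColimitsOfShape J (F.mapHomologicalComplex c) :=
  HomologicalComplex.preservesColimitsOfShape_of_eval _ (fun n ↦
    inferInstanceAs (PreservesColimitsOfShape J (HomologicalComplex.eval C c n ⋙ F)))

/-- If `L` is an essentially surjective functor preserving coproducts of shape `J`, then a functor
`G` preserves them as soon as `L ⋙ G` does. -/
lemma Limits.preservesColimitsOfShape_discrete_of_essSurj {C D E : Type*} [Category* C]
    [Category* D] [Category* E] (L : C ⥤ D) [L.EssSurj] (G : D ⥤ E) (J : Type*)
    [HasCoproductsOfShape J C] [PreservesColimitsOfShape (Discrete J) L]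
    [PreservesColimitsOfShape (Discrete J) (L ⋙ G)] :
    PreservesColimitsOfShape (Discrete J) G where
  preservesColimit {K} := by
    let K' : Discrete J ⥤ C := Discrete.functor (fun j ↦ L.objPreimage (K.obj ⟨j⟩))
    let e : K' ⋙ L ≅ K := Discrete.natIso (fun j ↦ L.objObjPreimageIso (K.obj j))
    have : PreservesColimit (K' ⋙ L) G :=
      preservesColimit_of_preserves_colimit_cocone
        (isColimitOfPreserves L (colimit.isColimit K'))
        (isColimitOfPreserves (L ⋙ G) (colimit.isColimit K'))
    exact preservesColimit_of_iso_diagram G e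

end CategoryTheory

theorem stmt_4
    {A : Type u} [Category.{v} A] [Abelian A] [HasColimits A] [AB5 A] [HasSeparator A]
    [HasDerivedCategory.{w} A]
    {B : Type u'} [Category.{v} B] [Abelian B] [HasColimits B] [AB5 B] [HasSeparator B]
    [HasDerivedCategory.{w'} B]
    (F : A ⥤ B) [F.Additive] [PreservesFiniteLimits F] [PreservesFiniteColimits F]
    (hF : StronglyAdditive.{v} F) :
    StronglyAdditive.{v} F.mapDerivedCategory := by
  intro J
  have : HasFiniteBiproducts A := Abelian.hasFiniteBiproducts
  have : HasFiniteBiproducts B := Abelian.hasFiniteBiproducts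
  have := AB4.of_AB5 A
  have := AB4.of_AB5 B
  obtain ⟨_⟩ := hF J
  have := DerivedCategory.preservesColimitsOfShape_Q (C := A) J
  have := DerivedCategory.preservesColimitsOfShape_Q (C := B) J
  have := F.preservesColimitsOfShape_mapHomologicalComplex (.up ℤ) (Discrete J)
  have : PreservesColimitsOfShape (Discrete J) (DerivedCategory.Q ⋙ F.mapDerivedCategory) :=
    preservesColimitsOfShape_of_natIso F.mapDerivedCategoryFactors.symm
  exact ⟨preservesColimitsOfShape_discrete_of_essSurj DerivedCategory.Q F.mapDerivedCategory J⟩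
end

section
/- Let F : 𝓐 → 𝓑 be a left exact, strongly additive functor between Grothendieck abelian categories, and suppose that in 𝓐 all small direct sums of injective objects are F-acyclic (i.e., R^pF vanishes on them for p > 0). Then for every p > 0 the classical right derived functor R^pF : 𝓐 → 𝓑 is strongly additive. -/
/-!
Statement 7 (Lemma A.6 of the paper): let `F : A ⥤ B` be a left exact, strongly additive
functor between Grothendieck abelian categories such that in `A` all small direct sums of
injective objects are `F`-acyclic. Then for every `p > 0` the classical right derived
functor `R^p F` is strongly additive.
-/

open CategoryTheory Limits

universe w v u u'

namespace CategoryTheory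

section InjectiveResolutionConstruction

variable {C : Type u} [Category.{v} C] [Abelian C]

/-- An exact augmented complex of injective objects, as an injective resolution. -/
noncomputable def InjectiveResolution.ofExact {X : C} (K : CochainComplex C ℕ)
    (hK : ∀ n, Injective (K.X n)) (f : X ⟶ K.X 0) [Mono f] (w : f ≫ K.d 0 1 = 0)
    (hf : (ShortComplex.mk f (K.d 0 1) w).Exact) (hex : ∀ n, K.ExactAt (n + 1)) :
    InjectiveResolution X where
  cocomplex := K
  injective := hK
  ι := (CochainComplex.fromSingle₀Equiv _ _).symm ⟨f, w⟩
  quasiIso := ⟨fun n => by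
    cases n
    · rw [CochainComplex.quasiIsoAt₀_iff, ShortComplex.quasiIso_iff_of_zeros]
      · refine (ShortComplex.exact_and_mono_f_iff_of_iso ?_).2 ⟨hf, ‹_›⟩
        refine ShortComplex.isoMk (Iso.refl _) (Iso.refl _) (Iso.refl _) ?_ ?_
        · refine (Category.id_comp _).trans (Eq.trans ?_ (Category.comp_id _).symm)
          exact (CochainComplex.fromSingle₀Equiv_symm_apply_f_zero _ _).symm
        · exact (Category.id_comp _).trans (Category.comp_id _).symm
      · rfl
      · rfl
      · exact K.shape _ _ (by simp)
    · rw [quasiIsoAt_iff_exactAt]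
      · apply hex
      · apply CochainComplex.exactAt_succ_single_obj⟩

/-- The augmentation of an injective resolution. -/
noncomputable def InjectiveResolution.aug {X : C} (I : InjectiveResolution X) :
    X ⟶ I.cocomplex.X 0 := I.ι.f 0

lemma InjectiveResolution.aug_d {X : C} (I : InjectiveResolution X) :
    I.aug ≫ I.cocomplex.d 0 1 = 0 := I.ι_f_zero_comp_complex_d

instance {X : C} (I : InjectiveResolution X) : Mono I.aug :=
  inferInstanceAs (Mono (I.ι.f 0))

lemma InjectiveResolution.exact_aug {X : C} (I : InjectiveResolution X) :
    (ShortComplex.mk _ _ I.aug_d).Exact :=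
  ShortComplex.exact_of_f_is_kernel _ I.isLimitKernelFork

lemma augment_exactAt_succ {X' J : C} (I : InjectiveResolution X') (g : J ⟶ X') [Epi g] (n : ℕ)
    (w : (g ≫ I.aug) ≫ I.cocomplex.d 0 1 = 0) :
    (CochainComplex.augment I.cocomplex (g ≫ I.aug) w).ExactAt (n + 1) := by
  rw [HomologicalComplex.exactAt_iff' _ n (n + 1) (n + 2) (by simp) (by simp)]
  cases n with
  | zero =>
    let α : ShortComplex.mk (g ≫ I.aug) (I.cocomplex.d 0 1) w ⟶
        ShortComplex.mk _ _ I.aug_d :=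
      { τ₁ := g, τ₂ := 𝟙 _, τ₃ := 𝟙 _ }
    have : Epi α.τ₁ := ‹Epi g›
    have : IsIso α.τ₂ := inferInstanceAs (IsIso (𝟙 _))
    have : Mono α.τ₃ := inferInstanceAs (Mono (𝟙 _))
    exact (ShortComplex.exact_iff_of_epi_of_isIso_of_mono α).2 I.exact_aug
  | succ n => exact I.exact_succ n

/-- Splicing an injective object to an injective resolution of the cokernel. -/
noncomputable def InjectiveResolution.splice {S : ShortComplex C} (hS : S.ShortExact)
    [hJ : Injective S.X₂] (I : InjectiveResolution S.X₃) : InjectiveResolution S.X₁ :=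
  have := hS.epi_g
  have : Mono (Y := (CochainComplex.augment I.cocomplex (S.g ≫ I.aug) (by simp [I.aug_d])).X 0)
    S.f := hS.mono_f
  InjectiveResolution.ofExact
    (CochainComplex.augment I.cocomplex (S.g ≫ I.aug) _)
    (fun n => by
      cases n with
      | zero => exact hJ
      | succ n => exact I.injective n) S.f _ (by
        let α : S ⟶ ShortComplex.mk S.f (S.g ≫ I.aug) (by simp) :=
          { τ₁ := 𝟙 _, τ₂ := 𝟙 _, τ₃ := I.aug }
        have : Epi α.τ₁ := inferInstanceAs (Epi (𝟙 _))
        have : IsIso α.τ₂ := inferInstanceAs (IsIso (𝟙 _))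
        have : Mono α.τ₃ := inferInstanceAs (Mono I.aug)
        exact (ShortComplex.exact_iff_of_epi_of_isIso_of_mono α).1 hS.exact)
    (fun n => augment_exactAt_succ _ _ _ _)

end InjectiveResolutionConstruction

section DimensionShifting

variable {C : Type u} [Category.{v} C] [Abelian C] [HasInjectiveResolutions C]
  {D : Type u'} [Category.{w} D] [Abelian D] (F : C ⥤ D) [F.Additive]

lemma isZero_rightDerived_succ_iff {X : C} (I : InjectiveResolution X) (n : ℕ) :
    IsZero ((F.rightDerived (n + 1)).obj X) ↔
      (ShortComplex.mk (F.map (I.cocomplex.d n (n + 1))) (F.map (I.cocomplex.d (n + 1) (n + 2)))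
        (by rw [← F.map_comp, I.cocomplex.d_comp_d, F.map_zero])).Exact := by
  refine (Iso.isZero_iff (I.isoRightDerivedObj F (n + 1))).trans ?_
  refine (HomologicalComplex.exactAt_iff_isZero_homology _ _).symm.trans ?_
  rw [HomologicalComplex.exactAt_iff' _ n (n + 1) (n + 2) (by simp) (by simp)]
  rfl

lemma isZero_rightDerived_add_two_iff {S : ShortComplex C} (hS : S.ShortExact)
    [Injective S.X₂] (n : ℕ) :
    IsZero ((F.rightDerived (n + 2)).obj S.X₁) ↔ IsZero ((F.rightDerived (n + 1)).obj S.X₃) := by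
  rw [isZero_rightDerived_succ_iff F (injectiveResolution S.X₃),
    isZero_rightDerived_succ_iff F ((injectiveResolution S.X₃).splice hS)]
  rfl

lemma isZero_rightDerived_one_iff [PreservesFiniteLimits F] {S : ShortComplex C}
    (hS : S.ShortExact) [Injective S.X₂] :
    IsZero ((F.rightDerived 1).obj S.X₁) ↔ Epi (F.map S.g) := by
  let I := injectiveResolution S.X₃
  have w₁ : F.map I.aug ≫ F.map (I.cocomplex.d 0 1) = 0 := by
    rw [← F.map_comp, I.aug_d, F.map_zero]
  have w₂ : F.map (S.g ≫ I.aug) ≫ F.map (I.cocomplex.d 0 1) = 0 := by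
    rw [F.map_comp, Category.assoc, w₁, comp_zero]
  have hk : (ShortComplex.mk _ _ w₁).Exact :=
    ShortComplex.exact_of_f_is_kernel _ (KernelFork.mapIsLimit _ I.isLimitKernelFork F)
  have hm : Mono (F.map I.aug) := inferInstance
  refine (isZero_rightDerived_succ_iff F (I.splice hS) 0).trans ?_
  change (ShortComplex.mk _ _ w₂).Exact ↔ _
  constructor
  · intro h
    rw [epi_iff_surjective_up_to_refinements]
    intro T y
    obtain ⟨T', π, hπ, x, hx⟩ := h.exact_up_to_refinements (y ≫ F.map I.aug)
      (by simp [w₁])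
    refine ⟨T', π, hπ, x, ?_⟩
    rw [← cancel_mono (F.map I.aug), Category.assoc, Category.assoc, ← F.map_comp]
    exact hx
  · intro h
    let α : ShortComplex.mk _ _ w₂ ⟶ ShortComplex.mk _ _ w₁ :=
      { τ₁ := F.map S.g, τ₂ := 𝟙 _, τ₃ := 𝟙 _ }
    have : Epi α.τ₁ := h
    have : IsIso α.τ₂ := inferInstanceAs (IsIso (𝟙 _))
    have : Mono α.τ₃ := inferInstanceAs (Mono (𝟙 _))
    exact (ShortComplex.exact_iff_of_epi_of_isIso_of_mono α).2 hk

/-- Given a short exact sequence `0 ⟶ S.X₁ ⟶ S.X₂ ⟶ S.X₃ ⟶ 0` and a monomorphism `S.X₂ ⟶ J`,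
the cokernels of `S.X₁ ⟶ J` and `S.X₂ ⟶ J` are related by a short exact sequence. -/
lemma exists_shortExact_of_mono {C : Type u} [Category.{v} C] [Abelian C]
    {S : ShortComplex C} (hS : S.ShortExact) {J : C} (i : S.X₂ ⟶ J) [Mono i] :
    ∃ (X Y : C) (a : J ⟶ X) (b : S.X₃ ⟶ X) (c : X ⟶ Y) (w₁ : (S.f ≫ i) ≫ a = 0)
      (w₂ : b ≫ c = 0) (w₃ : i ≫ a ≫ c = 0), (ShortComplex.mk _ _ w₁).ShortExact ∧
      (ShortComplex.mk _ _ w₂).ShortExact ∧ (ShortComplex.mk _ _ w₃).ShortExact ∧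
      S.g ≫ b = i ≫ a := by
  have := hS.mono_f
  have := hS.epi_g
  let a := cokernel.π (S.f ≫ i)
  let c : cokernel (S.f ≫ i) ⟶ cokernel i :=
    cokernel.desc _ (cokernel.π i) (by rw [Category.assoc, cokernel.condition, comp_zero])
  have hac : a ≫ c = cokernel.π i := cokernel.π_desc _ _ _
  have hia : S.f ≫ i ≫ a = 0 := by rw [← Category.assoc]; exact cokernel.condition _
  let b : S.X₃ ⟶ cokernel (S.f ≫ i) := hS.exact.desc (i ≫ a) hia
  have hgb : S.g ≫ b = i ≫ a := hS.exact.g_desc _ _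
  have w₁ : (S.f ≫ i) ≫ a = 0 := cokernel.condition _
  have w₃ : i ≫ a ≫ c = 0 := by rw [hac, cokernel.condition]
  have w₂ : b ≫ c = 0 := by
    rw [← cancel_epi S.g, reassoc_of% hgb, w₃, comp_zero]
  have h₁ : (ShortComplex.mk _ _ w₁).ShortExact :=
    { exact := ShortComplex.exact_cokernel _
      mono_f := inferInstanceAs (Mono (S.f ≫ i))
      epi_g := inferInstanceAs (Epi (cokernel.π _)) }
  have hEpi : Epi (a ≫ c) := by rw [hac]; infer_instance
  have h₃ : (ShortComplex.mk _ _ w₃).ShortExact :=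
    { exact := ShortComplex.exact_of_g_is_cokernel _
        (IsColimit.ofIsoColimit (cokernelIsCokernel i) (Cofork.ext (Iso.refl _) (by
          simpa using hac.symm)))
      mono_f := inferInstanceAs (Mono i)
      epi_g := hEpi }
  refine ⟨_, _, a, b, c, w₁, w₂, w₃, h₁, ?_, h₃, hgb⟩
  have hb : Mono b := by
    refine Preadditive.mono_of_cancel_zero _ fun {T} x hx => ?_
    obtain ⟨T', π, hπ, y, hy⟩ := surjective_up_to_refinements_of_epi S.g x
    obtain ⟨T'', π', hπ', z, hz⟩ := h₁.exact.exact_up_to_refinements (y ≫ i)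
      (by
        change (y ≫ i) ≫ a = 0
        rw [Category.assoc, ← hgb, ← reassoc_of% hy, hx, comp_zero])
    have hz' : π' ≫ y = z ≫ S.f := by
      rw [← cancel_mono i, Category.assoc, Category.assoc]
      exact hz
    rw [← cancel_epi π, ← cancel_epi π', hy, reassoc_of% hz', S.zero]
    simp
  refine { exact := ?_, mono_f := hb, epi_g := epi_of_epi_fac hac }
  rw [ShortComplex.exact_iff_exact_up_to_refinements]
  intro T x hx
  obtain ⟨T', π, hπ, y, hy⟩ := surjective_up_to_refinements_of_epi a x
  obtain ⟨T'', π', hπ', z, hz⟩ := h₃.exact.exact_up_to_refinements y (by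
    change y ≫ a ≫ c = 0
    rw [← Category.assoc, ← hy, Category.assoc]
    rw [show x ≫ c = 0 from hx, comp_zero])
  refine ⟨T'', π' ≫ π, inferInstance, z ≫ S.g, ?_⟩
  change (π' ≫ π) ≫ x = (z ≫ S.g) ≫ b
  rw [Category.assoc, hy, Category.assoc, hgb, ← Category.assoc, ← Category.assoc]
  exact hz =≫ a

lemma ShortComplex.ShortExact.exact_map_of_preservesFiniteLimits {C : Type u} [Category.{v} C] [Abelian C]
    {D : Type u'} [Category.{w} D] [Abelian D] (F : C ⥤ D) [F.Additive]
    [PreservesFiniteLimits F] {S : ShortComplex C} (hS : S.ShortExact) :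
    (S.map F).Exact :=
  ((Functor.preservesFiniteLimits_iff_forall_exact_map_and_mono F).1 inferInstance S hS).1

lemma epi_map_of_isZero_rightDerived_one [EnoughInjectives C] [PreservesFiniteLimits F]
    {S : ShortComplex C} (hS : S.ShortExact) (h : IsZero ((F.rightDerived 1).obj S.X₁)) :
    Epi (F.map S.g) := by
  obtain ⟨X, Y, a, b, c, w₁, w₂, w₃, h₁, h₂, h₃, hgb⟩ :=
    exists_shortExact_of_mono hS (Injective.ι S.X₂)
  have hJ : Injective (ShortComplex.mk _ _ w₁).X₂ := Injective.injective_under _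
  have := (isZero_rightDerived_one_iff F h₁).1 h
  have := h₂.mono_f
  have hb : Mono b := h₂.mono_f
  rw [epi_iff_surjective_up_to_refinements]
  intro T y
  obtain ⟨T', π, hπ, x, hx⟩ := surjective_up_to_refinements_of_epi (F.map a) (y ≫ F.map b)
  have h₃' := h₃.exact_map_of_preservesFiniteLimits F
  obtain ⟨T'', π', hπ', (z : T'' ⟶ F.obj S.X₂), hz⟩ := h₃'.exact_up_to_refinements x (by
    change x ≫ F.map (a ≫ c) = 0
    rw [F.map_comp, ← Category.assoc, ← hx, Category.assoc, Category.assoc, ← F.map_comp, w₂,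
      F.map_zero, comp_zero, comp_zero])
  change π' ≫ x = z ≫ F.map (Injective.ι S.X₂) at hz
  refine ⟨T'', π' ≫ π, inferInstance, z, ?_⟩
  rw [← cancel_mono (F.map b), Category.assoc, Category.assoc, Category.assoc, hx,
    ← F.map_comp, hgb, F.map_comp, ← reassoc_of% hz]

lemma isZero_rightDerived_of_shortExact [EnoughInjectives C] [PreservesFiniteLimits F] (n : ℕ) :
    (∀ S : ShortComplex C, S.ShortExact → IsZero ((F.rightDerived (n + 1)).obj S.X₁) →
      IsZero ((F.rightDerived (n + 1)).obj S.X₃) → IsZero ((F.rightDerived (n + 1)).obj S.X₂)) ∧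
    (∀ S : ShortComplex C, S.ShortExact → IsZero ((F.rightDerived (n + 1)).obj S.X₂) →
      IsZero ((F.rightDerived (n + 2)).obj S.X₁) →
        IsZero ((F.rightDerived (n + 1)).obj S.X₃)) := by
  induction n with
  | zero =>
    refine ⟨fun S hS hS₁ hS₃ => ?_, fun S hS hS₂ hS₁ => ?_⟩
    · obtain ⟨X, Y, a, b, c, w₁, w₂, w₃, h₁, h₂, h₃, -⟩ :=
        exists_shortExact_of_mono hS (Injective.ι S.X₂)
      have : Injective (ShortComplex.mk _ _ w₁).X₂ := Injective.injective_under _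
      have : Injective (ShortComplex.mk _ _ w₃).X₂ := Injective.injective_under _
      have ha : Epi (F.map a) := (isZero_rightDerived_one_iff F h₁).1 hS₁
      have hc : Epi (F.map c) := epi_map_of_isZero_rightDerived_one F h₂ hS₃
      refine (isZero_rightDerived_one_iff F h₃).2 ?_
      change Epi (F.map (a ≫ c))
      rw [F.map_comp]
      infer_instance
    · obtain ⟨X, Y, a, b, c, w₁, w₂, w₃, h₁, h₂, h₃, -⟩ :=
        exists_shortExact_of_mono hS (Injective.ι S.X₂)
      obtain ⟨X', Y', a', b', c', w₁', w₂', w₃', h₁', h₂', h₃', hcb⟩ :=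
        exists_shortExact_of_mono h₂ (Injective.ι X)
      have : Injective (ShortComplex.mk _ _ w₁).X₂ := Injective.injective_under _
      have : Injective (ShortComplex.mk _ _ w₃).X₂ := Injective.injective_under _
      have : Injective (ShortComplex.mk _ _ w₁').X₂ := Injective.injective_under _
      have : Injective (ShortComplex.mk _ _ w₃').X₂ := Injective.injective_under _
      change c ≫ b' = Injective.ι X ≫ a' at hcb
      have hac : Epi (F.map (a ≫ c)) := (isZero_rightDerived_one_iff F h₃).1 hS₂
      have hc : Epi (F.map c) := epi_of_epi_fac (F.map_comp a c).symm
      have hac' : Epi (F.map (a' ≫ c')) := (isZero_rightDerived_one_iff F h₃').1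
        ((isZero_rightDerived_add_two_iff F h₁ 0).1 hS₁)
      have hc' : Epi (F.map c') := epi_of_epi_fac (F.map_comp a' c').symm
      have : Epi ((ShortComplex.mk _ _ w₂').map F).g := hc'
      refine (isZero_rightDerived_one_iff F h₁').2 ?_
      change Epi (F.map a')
      refine Preadditive.epi_of_cancel_zero _ fun {T} t ht => ?_
      have ht' : F.map b' ≫ t = 0 := by
        rw [← cancel_epi (F.map c), ← F.map_comp_assoc, hcb, F.map_comp, Category.assoc, ht,
          comp_zero, comp_zero]
      let t' : F.obj Y' ⟶ T := (h₂'.exact_map_of_preservesFiniteLimits F).desc t ht'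
      have htt' : F.map c' ≫ t' = t := (h₂'.exact_map_of_preservesFiniteLimits F).g_desc t ht'
      have : t' = 0 := by
        rw [← cancel_epi (F.map (a' ≫ c')), F.map_comp, Category.assoc, htt', ht, comp_zero]
      rw [← htt', this, comp_zero]
  | succ n hn =>
    refine ⟨fun S hS hS₁ hS₃ => ?_, fun S hS hS₂ hS₁ => ?_⟩
    · obtain ⟨X, Y, a, b, c, w₁, w₂, w₃, h₁, h₂, h₃, -⟩ :=
        exists_shortExact_of_mono hS (Injective.ι S.X₂)
      have : Injective (ShortComplex.mk _ _ w₁).X₂ := Injective.injective_under _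
      have : Injective (ShortComplex.mk _ _ w₃).X₂ := Injective.injective_under _
      exact (isZero_rightDerived_add_two_iff F h₃ n).2
        (hn.2 (ShortComplex.mk _ _ w₂) h₂ ((isZero_rightDerived_add_two_iff F h₁ n).1 hS₁) hS₃)
    · obtain ⟨X, Y, a, b, c, w₁, w₂, w₃, h₁, h₂, h₃, -⟩ :=
        exists_shortExact_of_mono hS (Injective.ι S.X₂)
      obtain ⟨X', Y', a', b', c', w₁', w₂', w₃', h₁', h₂', h₃', -⟩ :=
        exists_shortExact_of_mono h₂ (Injective.ι X)
      have : Injective (ShortComplex.mk _ _ w₁).X₂ := Injective.injective_under _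
      have : Injective (ShortComplex.mk _ _ w₃).X₂ := Injective.injective_under _
      have : Injective (ShortComplex.mk _ _ w₁').X₂ := Injective.injective_under _
      have : Injective (ShortComplex.mk _ _ w₃').X₂ := Injective.injective_under _
      exact (isZero_rightDerived_add_two_iff F h₁' n).2
        (hn.1 (ShortComplex.mk _ _ w₂') h₂' ((isZero_rightDerived_add_two_iff F h₃ n).1 hS₂)
          ((isZero_rightDerived_add_two_iff F h₃' n).1
            ((isZero_rightDerived_add_two_iff F h₁ (n + 1)).1 hS₁)))

/-- An object is right acyclic for `F` if all higher right derived functors of `F` vanish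
on it. -/
def IsRightAcyclic (X : C) : Prop := ∀ n : ℕ, IsZero ((F.rightDerived (n + 1)).obj X)

variable {F} in
lemma IsRightAcyclic.X₂ [EnoughInjectives C] [PreservesFiniteLimits F] {S : ShortComplex C}
    (hS : S.ShortExact) (h₁ : IsRightAcyclic F S.X₁) (h₃ : IsRightAcyclic F S.X₃) :
    IsRightAcyclic F S.X₂ :=
  fun n => (isZero_rightDerived_of_shortExact F n).1 S hS (h₁ n) (h₃ n)

variable {F} in
lemma IsRightAcyclic.X₃ [EnoughInjectives C] [PreservesFiniteLimits F] {S : ShortComplex C}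
    (hS : S.ShortExact) (h₁ : IsRightAcyclic F S.X₁) (h₂ : IsRightAcyclic F S.X₂) :
    IsRightAcyclic F S.X₃ :=
  fun n => (isZero_rightDerived_of_shortExact F n).2 S hS (h₂ n) (h₁ (n + 1))

variable {F} in
lemma IsRightAcyclic.of_iso {X Y : C} (h : IsRightAcyclic F X) (e : X ≅ Y) :
    IsRightAcyclic F Y :=
  fun n => (h n).of_iso ((F.rightDerived (n + 1)).mapIso e.symm)

variable {F} in
lemma IsRightAcyclic.of_isZero {X : C} (h : IsZero X) : IsRightAcyclic F X :=
  fun n => by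
    have := h.injective
    exact Functor.isZero_rightDerived_obj_injective_succ F n X

end DimensionShifting

end CategoryTheory
namespace HomologicalComplex

section ExtendMap

variable {ι ι' : Type*} {c : ComplexShape ι} {c' : ComplexShape ι'} (e : c.Embedding c')
  {C : Type u} [Category.{v} C] [Preadditive C] [HasZeroObject C]
  {D : Type u'} [Category.{w} D] [Preadditive D] [HasZeroObject D] (F : C ⥤ D) [F.Additive]

/-- The components of the comparison isomorphism between the extension of complexes and
the application of an additive functor. -/
noncomputable def mapExtendXIso (K : HomologicalComplex C c) : ∀ i : Option ι,
    F.obj (extend.X K i) ≅ extend.X ((F.mapHomologicalComplex c).obj K) i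
  | some _ => Iso.refl _
  | none => (F.map_isZero (extend.isZero_X K rfl)).iso (extend.isZero_X _ rfl)

lemma mapExtendXIso_comm_d (K : HomologicalComplex C c) (i j : Option ι) :
    (mapExtendXIso F K i).hom ≫ extend.d ((F.mapHomologicalComplex c).obj K) i j =
      F.map (extend.d K i j) ≫ (mapExtendXIso F K j).hom := by
  match i, j with
  | none, _ => exact (F.map_isZero (extend.isZero_X K rfl)).eq_of_src _ _
  | some _, none => exact (extend.isZero_X _ rfl).eq_of_tgt _ _
  | some i, some j => exact (Category.id_comp _).trans (Category.comp_id _).symm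

lemma mapExtendXIso_naturality {K L : HomologicalComplex C c} (φ : K ⟶ L) (i : Option ι) :
    F.map (extend.mapX φ i) ≫ (mapExtendXIso F L i).hom =
      (mapExtendXIso F K i).hom ≫ extend.mapX ((F.mapHomologicalComplex c).map φ) i := by
  match i with
  | none => exact (extend.isZero_X _ rfl).eq_of_tgt _ _
  | some i => exact (Category.comp_id _).trans (Category.id_comp _).symm

/-- Additive functors commute with the extension of complexes. -/
noncomputable def mapExtendIso (K : HomologicalComplex C c) :
    (F.mapHomologicalComplex c').obj (K.extend e) ≅
      ((F.mapHomologicalComplex c).obj K).extend e :=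
  Hom.isoOfComponents (fun i => mapExtendXIso F K (e.r i))
    (fun _ _ _ => mapExtendXIso_comm_d F K _ _)

lemma mapExtendIso_naturality {K L : HomologicalComplex C c} (φ : K ⟶ L) :
    (F.mapHomologicalComplex c').map (extendMap φ e) ≫ (mapExtendIso e F L).hom =
      (mapExtendIso e F K).hom ≫ extendMap ((F.mapHomologicalComplex c).map φ) e := by
  ext i
  exact mapExtendXIso_naturality F φ (e.r i)

end ExtendMap

end HomologicalComplex

namespace CochainComplex

variable {C : Type u} [Category.{v} C] [Abelian C]

lemma quasiIso_iff_exactAt_mappingCone {K L : CochainComplex C ℤ} (φ : K ⟶ L) :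
    QuasiIso φ ↔ ∀ n, (mappingCone φ).ExactAt n := by
  rw [← HomotopyCategory.quotient_obj_mem_subcategoryAcyclic_iff_exactAt,
    ← HomologicalComplex.mem_quasiIso_iff,
    ← HomotopyCategory.quotient_map_mem_quasiIso_iff,
    HomotopyCategory.quasiIso_eq_trW_subcategoryAcyclic]
  exact (HomotopyCategory.subcategoryAcyclic C).trW_iff_of_distinguished _
    (HomotopyCategory.mappingCone_triangleh_distinguished φ)

lemma shortExact_cycles (K : CochainComplex C ℤ) (n : ℤ) (h : K.ExactAt (n + 1)) :
    (ShortComplex.mk (K.iCycles n) (K.toCycles n (n + 1)) (by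
      rw [← cancel_mono (K.iCycles (n + 1))]; simp)).ShortExact where
  mono_f := inferInstanceAs (Mono (K.iCycles n))
  epi_g := by
    change Epi (K.toCycles n (n + 1))
    rw [HomologicalComplex.exactAt_iff_isZero_homology] at h
    exact Preadditive.epi_of_isZero_cokernel' _
      (K.homologyIsCokernel n (n + 1) (by simp)) h
  exact := by
    let α : ShortComplex.mk (K.iCycles n) (K.toCycles n (n + 1)) (by
        rw [← cancel_mono (K.iCycles (n + 1))]; simp) ⟶
      ShortComplex.mk (K.iCycles n) (K.d n (n + 1)) (by simp) :=
      { τ₁ := 𝟙 _, τ₂ := 𝟙 _, τ₃ := K.iCycles (n + 1) }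
    have : Epi α.τ₁ := inferInstanceAs (Epi (𝟙 _))
    have : IsIso α.τ₂ := inferInstanceAs (IsIso (𝟙 _))
    have : Mono α.τ₃ := inferInstanceAs (Mono (K.iCycles (n + 1)))
    rw [ShortComplex.exact_iff_of_epi_of_isIso_of_mono α]
    exact ShortComplex.exact_of_f_is_kernel _ (K.cyclesIsKernel n (n + 1) (by simp))

/-- The mapping cone is, in each degree, an extension of the source by the target. -/
lemma shortExact_mappingCone {K L : CochainComplex C ℤ} (φ : K ⟶ L) (n : ℤ) :
    ∃ (f : L.X n ⟶ (mappingCone φ).X n) (g : (mappingCone φ).X n ⟶ K.X (n + 1))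
      (w : f ≫ g = 0), (ShortComplex.mk f g w).ShortExact := by
  refine ⟨(mappingCone.inr φ).f n, (mappingCone.fst φ).1.v n (n + 1) rfl, by simp, ?_⟩
  refine ShortComplex.Splitting.shortExact
    { r := (mappingCone.snd φ).v n n (add_zero n)
      s := (mappingCone.inl φ).v (n + 1) n (by lia)
      f_r := by simp
      s_g := by simp
      id := ?_ }
  exact (add_comm _ _).trans (mappingCone.id_X φ n (n + 1) rfl)

end CochainComplex

namespace CategoryTheory

variable {C : Type u} [Category.{v} C] [Abelian C] [EnoughInjectives C]
  {D : Type u'} [Category.{w} D] [Abelian D] {F : C ⥤ D} [F.Additive]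

lemma IsRightAcyclic.extend {K : CochainComplex C ℕ} (hK : ∀ n, IsRightAcyclic F (K.X n))
    (n : ℤ) : IsRightAcyclic F ((K.extend ComplexShape.embeddingUpNat).X n) := by
  by_cases h : ∃ i, ComplexShape.embeddingUpNat.f i = n
  · obtain ⟨i, hi⟩ := h
    exact (hK i).of_iso (K.extendXIso _ hi).symm
  · exact .of_isZero (K.isZero_extend_X _ _ fun i hi => h ⟨i, hi⟩)

variable [PreservesFiniteLimits F]

lemma IsRightAcyclic.cycles {K : CochainComplex C ℤ} (hK : ∀ n, IsRightAcyclic F (K.X n))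
    (hex : ∀ n, K.ExactAt n) (n₀ : ℤ) [K.IsStrictlyGE n₀] (n : ℤ) :
    IsRightAcyclic F (K.cycles n) := by
  have hlt (n : ℤ) (hn : n < n₀) : IsRightAcyclic F (K.cycles n) :=
    .of_isZero ((K.isZero_of_isStrictlyGE n₀ n hn).of_mono (K.iCycles n))
  have hnat (k : ℕ) : IsRightAcyclic F (K.cycles (n₀ - 1 + k)) := by
    induction k with
    | zero => exact hlt _ (by simp)
    | succ k hk =>
      have := IsRightAcyclic.X₃ (CochainComplex.shortExact_cycles K _ (hex _)) hk (hK _)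
      rw [Nat.cast_add, Nat.cast_one, ← add_assoc]
      exact this
  obtain hn | hn := lt_or_ge n n₀
  · exact hlt n hn
  · obtain ⟨k, rfl⟩ : ∃ k : ℕ, n = n₀ - 1 + k := ⟨(n - n₀ + 1).toNat, by lia⟩
    exact hnat k

lemma exactAt_mapHomologicalComplex_of_isRightAcyclic {K : CochainComplex C ℤ}
    (hK : ∀ n, IsRightAcyclic F (K.X n)) (hex : ∀ n, K.ExactAt n) (n₀ : ℤ)
    [K.IsStrictlyGE n₀] (n : ℤ) :
    ((F.mapHomologicalComplex _).obj K).ExactAt n := by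
  obtain ⟨n, rfl⟩ : ∃ m, n = m + 1 := ⟨n - 1, by simp⟩
  rw [HomologicalComplex.exactAt_iff' _ n (n + 1) (n + 1 + 1) (by simp) (by simp)]
  have w₁ : F.map (K.d n (n + 1)) ≫ F.map (K.d (n + 1) (n + 1 + 1)) = 0 := by
    rw [← F.map_comp, K.d_comp_d, F.map_zero]
  have w₂ : F.map (K.iCycles (n + 1)) ≫ F.map (K.d (n + 1) (n + 1 + 1)) = 0 := by
    rw [← F.map_comp, K.iCycles_d, F.map_zero]
  change (ShortComplex.mk _ _ w₁).Exact
  let α : ShortComplex.mk _ _ w₁ ⟶ ShortComplex.mk _ _ w₂ :=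
    { τ₁ := F.map (K.toCycles n (n + 1)), τ₂ := 𝟙 _, τ₃ := 𝟙 _
      comm₁₂ := by
        change F.map _ ≫ F.map _ = F.map _ ≫ 𝟙 _
        rw [Category.comp_id, ← F.map_comp, K.toCycles_i] }
  have : Epi α.τ₁ := epi_map_of_isZero_rightDerived_one F
    (CochainComplex.shortExact_cycles K n (hex _)) (IsRightAcyclic.cycles hK hex n₀ n 0)
  have : IsIso α.τ₂ := inferInstanceAs (IsIso (𝟙 _))
  have : Mono α.τ₃ := inferInstanceAs (Mono (𝟙 _))
  rw [ShortComplex.exact_iff_of_epi_of_isIso_of_mono α]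
  exact ShortComplex.exact_of_f_is_kernel _
    (KernelFork.mapIsLimit _ (K.cyclesIsKernel (n + 1) _ (by simp)) F)

lemma quasiIso_mapHomologicalComplex_of_isRightAcyclic_int {K L : CochainComplex C ℤ}
    (φ : K ⟶ L) [QuasiIso φ] (hK : ∀ n, IsRightAcyclic F (K.X n))
    (hL : ∀ n, IsRightAcyclic F (L.X n)) (n₀ : ℤ) [K.IsStrictlyGE n₀] [L.IsStrictlyGE n₀] :
    QuasiIso ((F.mapHomologicalComplex _).map φ) := by
  rw [CochainComplex.quasiIso_iff_exactAt_mappingCone]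
  intro n
  have := CochainComplex.isStrictlyGE_mappingCone φ n₀ n₀ (n₀ - 1)
  refine HomologicalComplex.ExactAt.of_iso ?_
    (CochainComplex.mappingCone.mapHomologicalComplexIso φ F)
  refine exactAt_mapHomologicalComplex_of_isRightAcyclic (fun m => ?_)
    ((CochainComplex.quasiIso_iff_exactAt_mappingCone φ).1 inferInstance) (n₀ - 1) n
  obtain ⟨f, g, w, h⟩ := CochainComplex.shortExact_mappingCone φ m
  exact .X₂ h (hL m) (hK (m + 1))

/-- A left exact functor sends quasi-isomorphisms between nonnegatively graded complexes of
acyclic objects to quasi-isomorphisms. -/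
lemma quasiIso_mapHomologicalComplex_of_isRightAcyclic {K L : CochainComplex C ℕ}
    (φ : K ⟶ L) [QuasiIso φ] (hK : ∀ n, IsRightAcyclic F (K.X n))
    (hL : ∀ n, IsRightAcyclic F (L.X n)) :
    QuasiIso ((F.mapHomologicalComplex _).map φ) := by
  rw [← HomologicalComplex.quasiIso_extendMap_iff _ ComplexShape.embeddingUpNat]
  refine (quasiIso_iff_of_arrow_mk_iso
    ((F.mapHomologicalComplex _).map (HomologicalComplex.extendMap φ _)) _
    (Arrow.isoMk (HomologicalComplex.mapExtendIso ComplexShape.embeddingUpNat F K)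
      (HomologicalComplex.mapExtendIso ComplexShape.embeddingUpNat F L)
      (HomologicalComplex.mapExtendIso_naturality _ F φ).symm)).1 ?_
  have := (HomologicalComplex.quasiIso_extendMap_iff φ ComplexShape.embeddingUpNat).2 inferInstance
  exact quasiIso_mapHomologicalComplex_of_isRightAcyclic_int _ (.extend hK) (.extend hL) 0

end CategoryTheory

namespace CategoryTheory

variable {C : Type u} [Category.{v} C] [Abelian C] {J : Type*} [Category* J]

lemma ShortComplex.exact_of_forall_exact_evaluation (S : ShortComplex (J ⥤ C))
    (hS : ∀ j, (S.map ((evaluation J C).obj j)).Exact) : S.Exact := by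
  rw [ShortComplex.exact_iff_isZero_homology, Functor.isZero_iff]
  exact fun j => ((ShortComplex.exact_iff_isZero_homology _).1 (hS j)).of_iso
    (S.mapHomologyIso ((evaluation J C).obj j)).symm

/-- The cokernel of a morphism between functors which preserve colimits of shape `J` also
preserves these. -/
lemma preservesColimitsOfShape_of_isColimit_cokernelCofork {E : Type*} [Category* E]
    {G₁ G₂ G₃ : E ⥤ C} (f : G₁ ⟶ G₂) (g : G₂ ⟶ G₃) (w : ∀ X, f.app X ≫ g.app X = 0)
    (hg : ∀ X, IsColimit (CokernelCofork.ofπ (g.app X) (w X)))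
    [PreservesColimitsOfShape J G₁] [PreservesColimitsOfShape J G₂] :
    PreservesColimitsOfShape J G₃ where
  preservesColimit {K} := ⟨fun {c} hc => by
    have hepi (X : E) : Epi (g.app X) := epi_of_isColimit_cofork (hg X)
    have h₁ : IsColimit (G₁.mapCocone c) := isColimitOfPreserves G₁ hc
    have h₂ : IsColimit (G₂.mapCocone c) := isColimitOfPreserves G₂ hc
    refine ⟨IsColimit.ofExistsUnique fun t => ?_⟩
    obtain ⟨φ, hφ⟩ : ∃ φ : G₂.obj c.pt ⟶ t.pt, ∀ j, G₂.map (c.ι.app j) ≫ φ =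
        g.app (K.obj j) ≫ t.ι.app j :=
      ⟨h₂.desc ((Cocone.precompose (Functor.whiskerLeft K g)).obj t), h₂.fac _⟩
    have hfφ : f.app c.pt ≫ φ = 0 := h₁.hom_ext fun j => by
      change G₁.map (c.ι.app j) ≫ f.app c.pt ≫ φ = G₁.map (c.ι.app j) ≫ 0
      rw [comp_zero]
      refine (f.naturality_assoc (c.ι.app j) φ).trans ?_
      rw [hφ, ← Category.assoc, w]
      exact zero_comp
    let ψ : G₃.obj c.pt ⟶ t.pt := (hg c.pt).desc (CokernelCofork.ofπ φ hfφ)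
    have hψ : g.app c.pt ≫ ψ = φ := (hg c.pt).fac _ WalkingParallelPair.one
    have hj (j : J) (m : G₃.obj c.pt ⟶ t.pt) :
        g.app (K.obj j) ≫ G₃.map (c.ι.app j) ≫ m = G₂.map (c.ι.app j) ≫ g.app c.pt ≫ m :=
      (g.naturality_assoc (c.ι.app j) m).symm
    have hfac (j : J) : G₃.map (c.ι.app j) ≫ ψ = t.ι.app j := by
      refine (cancel_epi (g.app (K.obj j))).1 ((hj j ψ).trans ?_)
      rw [hψ]
      exact hφ j
    refine ⟨ψ, hfac, fun m hm => (cancel_epi (g.app c.pt)).1 (h₂.hom_ext fun j => ?_)⟩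
    exact ((hj j m).symm.trans (_ ≫= (hm j).trans (hfac j).symm)).trans (hj j ψ)⟩

/-- The kernel of a morphism between functors which preserve colimits of shape `J` also
preserves these when colimits of shape `J` are exact. -/
lemma preservesColimitsOfShape_of_isLimit_kernelFork {E : Type*} [Category* E]
    [HasColimitsOfShape J C] [HasExactColimitsOfShape J C]
    {G₁ G₂ G₃ : E ⥤ C} (f : G₁ ⟶ G₂) (g : G₂ ⟶ G₃) (w : ∀ X, f.app X ≫ g.app X = 0)
    (hf : ∀ X, IsLimit (KernelFork.ofι (f.app X) (w X)))
    [PreservesColimitsOfShape J G₂] [PreservesColimitsOfShape J G₃] :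
    PreservesColimitsOfShape J G₁ where
  preservesColimit {K} := ⟨fun {c} hc => by
    let S : ShortComplex (J ⥤ C) :=
      ShortComplex.mk (Functor.whiskerLeft K f) (Functor.whiskerLeft K g) (by
        ext j; exact w _)
    have hmono (X : E) : Mono (f.app X) := mono_of_isLimit_fork (hf X)
    have hS : S.Exact := ShortComplex.exact_of_forall_exact_evaluation S fun j =>
      ShortComplex.exact_of_f_is_kernel (ShortComplex.mk _ _ (w (K.obj j))) (hf _)
    have : Mono S.f := by
      have (j : J) : Mono ((Functor.whiskerLeft K f).app j) := hmono _
      exact NatTrans.mono_of_mono_app _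
    have hc₁ : IsColimit (colimit.cocone (K ⋙ G₁)) := colimit.isColimit _
    let s : colimit (K ⋙ G₁) ⟶ G₁.obj c.pt := hc₁.desc (G₁.mapCocone c)
    have hs (j : J) : colimit.ι (K ⋙ G₁) j ≫ s = G₁.map (c.ι.app j) := hc₁.fac _ _
    have hj (j : J) : colimit.ι (K ⋙ G₁) j ≫ s ≫ f.app c.pt =
        f.app (K.obj j) ≫ G₂.map (c.ι.app j) := by
      rw [reassoc_of% hs j]
      exact f.naturality _
    have h₂ : IsColimit (G₂.mapCocone c) := isColimitOfPreserves G₂ hc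
    have h₃ : IsColimit (G₃.mapCocone c) := isColimitOfPreserves G₃ hc
    let T : ShortComplex C := colim.mapShortComplex S hc₁ (G₂.mapCocone c) (G₃.mapCocone c)
      (s ≫ f.app c.pt) (g.app c.pt) hj (fun j => g.naturality _)
    have hT : T.Exact := colim.exact_mapShortComplex hS hc₁ h₂ h₃ _ _ hj _
    have hm : Mono T.f := colim.map_mono' S.f hc₁ h₂ _ hj
    have : Mono (s ≫ f.app c.pt) := hm
    have : Mono s := mono_of_mono s (f.app c.pt)
    let r : G₁.obj c.pt ⟶ colimit (K ⋙ G₁) := hT.lift (f.app c.pt) (w _)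
    have hr : r ≫ s ≫ f.app c.pt = f.app c.pt := hT.lift_f (f.app c.pt) (w _)
    have : IsSplitEpi s := ⟨⟨r, by rw [← cancel_mono (f.app c.pt), Category.assoc, hr,
      Category.id_comp]⟩⟩
    have : IsIso s := isIso_of_mono_of_isSplitEpi s
    exact ⟨IsColimit.ofIsoColimit hc₁ (Cocone.ext (asIso s) hs)⟩⟩

end CategoryTheory

namespace HomologicalComplex

variable {C : Type u} [Category.{v} C] [Abelian C] {ι : Type*} (c : ComplexShape ι) (n : ι)
  (J : Type*) [Category* J] [HasColimitsOfShape J C]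

instance preservesColimitsOfShape_opcyclesFunctor :
    PreservesColimitsOfShape J (opcyclesFunctor C c n) :=
  preservesColimitsOfShape_of_isColimit_cokernelCofork
    (G₁ := eval C c (c.prev n)) (G₂ := eval C c n)
    { app K := K.d _ n
      naturality _ _ φ := φ.comm _ _ }
    { app K := K.pOpcycles n
      naturality _ _ φ := (p_opcyclesMap φ n).symm }
    (fun K => K.d_pOpcycles _ _) (fun K => K.opcyclesIsCokernel _ n rfl)

instance preservesColimitsOfShape_homologyFunctor [HasExactColimitsOfShape J C] :
    PreservesColimitsOfShape J (homologyFunctor C c n) :=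
  preservesColimitsOfShape_of_isLimit_kernelFork (natTransHomologyι C c n)
    (G₃ := eval C c (c.next n))
    { app K := K.fromOpcycles n (c.next n)
      naturality K L φ := by
        change opcyclesMap φ n ≫ _ = _ ≫ φ.f _
        rw [← cancel_epi (K.pOpcycles n)]
        simp } (fun K => K.homologyι_comp_fromOpcycles _ _)
    (fun K => K.homologyIsKernel _ _ rfl)

variable {c J} in
lemma quasiIso_of_isColimit [HasExactColimitsOfShape J C] {K L : J ⥤ HomologicalComplex C c}
    (α : K ⟶ L) (hα : ∀ j, QuasiIso (α.app j)) {s : Cocone K} (hs : IsColimit s) {t : Cocone L}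
    (ht : IsColimit t) (φ : s.pt ⟶ t.pt) (hφ : ∀ j, s.ι.app j ≫ φ = α.app j ≫ t.ι.app j) :
    QuasiIso φ where
  quasiIsoAt n := by
    rw [quasiIsoAt_iff_isIso_homologyMap]
    have hiso (j : J) : IsIso ((Functor.whiskerRight α (homologyFunctor C c n)).app j) :=
      inferInstanceAs (IsIso (homologyMap (α.app j) n))
    have := NatIso.isIso_of_isIso_app (Functor.whiskerRight α (homologyFunctor C c n))
    let e := IsColimit.coconePointsIsoOfNatIso
      (isColimitOfPreserves (homologyFunctor C c n) hs)
      (isColimitOfPreserves (homologyFunctor C c n) ht)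
      (asIso (Functor.whiskerRight α (homologyFunctor C c n)))
    have he : e.hom = homologyMap φ n := by
      refine (isColimitOfPreserves (homologyFunctor C c n) hs).hom_ext fun j => ?_
      refine (IsColimit.comp_coconePointsIsoOfNatIso_hom _ _ _ _).trans ?_
      change homologyMap _ _ ≫ homologyMap _ _ = homologyMap _ _ ≫ homologyMap _ _
      rw [← homologyMap_comp, ← homologyMap_comp, hφ]
    exact he ▸ inferInstanceAs (IsIso e.hom)

end HomologicalComplex

namespace CategoryTheory

variable {A : Type u} [Category.{v} A] [Abelian A] [EnoughInjectives A]
  {B : Type u'} [Category.{w} B] [Abelian B] (F : A ⥤ B) [F.Additive] [PreservesFiniteLimits F]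

/-- If coproducts of families of injective objects indexed by `J` are acyclic for `F`, and if
`F` commutes with coproducts indexed by `J`, then so do its right derived functors. -/
lemma preservesColimitsOfShape_rightDerived (J : Type*)
    [HasColimitsOfShape (Discrete J) A] [HasExactColimitsOfShape (Discrete J) A]
    [HasColimitsOfShape (Discrete J) B] [HasExactColimitsOfShape (Discrete J) B]
    [PreservesColimitsOfShape (Discrete J) F]
    (hF : ∀ f : J → A, (∀ j, Injective (f j)) → IsRightAcyclic F (∐ f)) (p : ℕ) :
    PreservesColimitsOfShape (Discrete J) (F.rightDerived p) where
  preservesColimit {X} := ⟨fun {c} hc => by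
    let I (j : Discrete J) : InjectiveResolution (X.obj j) := injectiveResolution _
    let D : Discrete J ⥤ CochainComplex A ℕ := Discrete.functor fun j => (I ⟨j⟩).cocomplex
    let K := colimit D
    let L := injectiveResolution c.pt
    let φ : K ⟶ L.cocomplex := Limits.Sigma.desc fun j =>
      InjectiveResolution.desc (c.ι.app ⟨j⟩) L (I ⟨j⟩)
    have hφ (j : Discrete J) :
        colimit.ι D j ≫ φ = InjectiveResolution.desc (c.ι.app j) L (I j) := colimit.ι_desc _ _
    have hD : IsColimit (colimit.cocone D) := colimit.isColimit D
    have hK (n : ℕ) : IsRightAcyclic F (K.X n) :=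
      (hF (fun j => (I ⟨j⟩).cocomplex.X n) (fun j => (I ⟨j⟩).injective n)).of_iso
        (IsColimit.coconePointsIsoOfNatIso (colimit.isColimit _)
          (isColimitOfPreserves (HomologicalComplex.eval A _ n) hD)
          (Discrete.natIso fun _ => Iso.refl _))
    have hL (n : ℕ) : IsRightAcyclic F (L.cocomplex.X n) := fun m => by
      have := L.injective n
      exact F.isZero_rightDerived_obj_injective_succ m _
    have hS : IsColimit ((CochainComplex.single₀ A).mapCocone c) := isColimitOfPreserves _ hc
    let α : X ⋙ CochainComplex.single₀ A ⟶ D := Discrete.natTrans fun j => (I j).ι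
    let θ : (CochainComplex.single₀ A).obj c.pt ⟶ K :=
      hS.desc ((Cocone.precompose α).obj (colimit.cocone D))
    have hθ (j : Discrete J) :
        (CochainComplex.single₀ A).map (c.ι.app j) ≫ θ = (I j).ι ≫ colimit.ι D j := hS.fac _ _
    have : QuasiIso θ := HomologicalComplex.quasiIso_of_isColimit α
      (fun j => inferInstanceAs (QuasiIso (I j).ι)) hS hD θ hθ
    have hθφ : θ ≫ φ = L.ι := hS.hom_ext fun j => by
      change (CochainComplex.single₀ A).map (c.ι.app j) ≫ θ ≫ φ = _
      rw [reassoc_of% hθ j, hφ j]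
      exact InjectiveResolution.desc_commutes _ _ _
    have : QuasiIso (θ ≫ φ) := by rw [hθφ]; infer_instance
    have : QuasiIso φ := quasiIso_of_comp_left θ φ
    have := quasiIso_mapHomologicalComplex_of_isRightAcyclic φ hK hL
    let G := F.mapHomologicalComplex (ComplexShape.up ℕ) ⋙ HomologicalComplex.homologyFunctor B _ p
    have : IsIso (G.map φ) := inferInstanceAs
      (IsIso (HomologicalComplex.homologyMap ((F.mapHomologicalComplex _).map φ) p))
    let e : X ⋙ F.rightDerived p ≅ D ⋙ G := Discrete.natIso fun j => (I j).isoRightDerivedObj F p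
    let i : (F.rightDerived p).obj c.pt ≅ G.obj K :=
      L.isoRightDerivedObj F p ≪≫ (asIso (G.map φ)).symm
    refine ⟨(IsColimit.equivOfNatIsoOfIso e ((F.rightDerived p).mapCocone c)
      (G.mapCocone (colimit.cocone D)) (Cocone.ext i fun j => ?_)).symm
      (isColimitOfPreserves G hD)⟩
    change (((I j).isoRightDerivedObj F p).inv ≫ (F.rightDerived p).map (c.ι.app j)) ≫
      (L.isoRightDerivedObj F p).hom ≫ inv (G.map φ) = G.map (colimit.ι D j)
    rw [Category.assoc, Iso.inv_comp_eq,
      InjectiveResolution.isoRightDerivedObj_hom_naturality_assoc (c.ι.app j) (I j) L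
        (InjectiveResolution.desc (c.ι.app j) L (I j))
        (InjectiveResolution.desc_commutes_zero _ _ _), ← hφ]
    congr 1
    rw [IsIso.comp_inv_eq]
    exact G.map_comp _ _⟩

end CategoryTheory

theorem stmt_7
    {A : Type u} [Category.{v} A] [Abelian A] [HasColimits A] [AB5 A] [HasSeparator A]
    [EnoughInjectives A]
    {B : Type u'} [Category.{v} B] [Abelian B] [HasColimits B] [AB5 B] [HasSeparator B]
    (F : A ⥤ B) [F.Additive] [PreservesFiniteLimits F]
    (hF : StronglyAdditive.{v} F)
    (hacyclic : ∀ (J : Type v) (f : J → A), (∀ j, Injective (f j)) →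
      ∀ p : ℕ, 0 < p → IsZero ((F.rightDerived p).obj (∐ f)))
    (p : ℕ) (hp : 0 < p) :
    StronglyAdditive.{v} (F.rightDerived p) := by
  intro J
  have := (hF J).some
  have := Abelian.hasFiniteBiproducts (C := A)
  have := Abelian.hasFiniteBiproducts (C := B)
  have : AB4OfSize.{v} A := AB4.of_AB5 A
  have : AB4OfSize.{v} B := AB4.of_AB5 B
  exact ⟨preservesColimitsOfShape_rightDerived F J
    (fun f hf n => hacyclic J f hf _ n.succ_pos) p⟩
end
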